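/- Let P and Q be probability distributions on {−1,1}^d with |P̂(S) − Q̂(S)| ≤ θ for all S ⊆ {1,…,d}, and let h : {−1,1}^d → [−1,1]. For a ∈ {−1,1}^d, let P_a denote the pushforward of P under x ↦ (a_1 x_1, …, a_d x_d), and similarly Q_a. Then for every t > 0, Pr_{a∼Unif({−1,1}^d)}[|E_{x∼P_a}[h(x)] − E_{x∼Q_a}[h(x)]| ≥ t] ≤ θ²/t². -/

import Mathlib

open MeasureTheory

/-- The Boolean cube `{-1,1}^d` inside `Fin d → ℝ`. -/
def cube (d : ℕ) : Set (Fin d → ℝ) := {x | ∀ i, x i = 1 ∨ x i = -1}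

/-- The Fourier coefficient `D̂(S) = E_{x∼D}[∏_{i∈S} x_i]` of a distribution on `{-1,1}^d`. -/
noncomputable def cubeFourier {d : ℕ} (D : Measure (Fin d → ℝ)) (S : Finset (Fin d)) : ℝ :=
  ∫ x, ∏ i ∈ S, x i ∂D

/-- The `±1` vector associated with a Boolean vector. -/
def sgnVec {d : ℕ} (b : Fin d → Bool) : Fin d → ℝ := fun i => if b i then 1 else -1

/-- The pushforward `P_a` of `P` under the coordinatewise product map
`x ↦ (a₁x₁, …, a_dx_d)`. -/
noncomputable def flipped {d : ℕ} (P : Measure (Fin d → ℝ)) (a : Fin d → ℝ) :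
    Measure (Fin d → ℝ) :=
  Measure.map (fun x i => a i * x i) P

theorem sgnVec_mul_self {d : ℕ} (a : Fin d → Bool) (i : Fin d) :
    sgnVec a i * sgnVec a i = 1 := by
  unfold sgnVec; split_ifs <;> norm_num

theorem sgnVec_injective {d : ℕ} : Function.Injective (sgnVec (d := d)) := by
  intro a b hab
  funext i
  have hi := congrFun hab i
  unfold sgnVec at hi
  cases ha : a i <;> cases hb : b i <;> simp [ha, hb] at hi ⊢ <;> linarith

theorem range_sgnVec (d : ℕ) : Set.range (sgnVec (d := d)) = cube d := by
  ext x
  constructor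
  · rintro ⟨b, rfl⟩ i
    unfold sgnVec; split_ifs <;> simp
  · intro hx
    refine ⟨fun i => decide (x i = 1), funext fun i => ?_⟩
    rcases hx i with hi | hi <;> norm_num [sgnVec, hi]

/-- The coordinatewise product of two sign vectors, as a Boolean vector. -/
def signMul {d : ℕ} (a b : Fin d → Bool) : Fin d → Bool := fun i => a i == b i

theorem sgnVec_signMul {d : ℕ} (a b : Fin d → Bool) (i : Fin d) :
    sgnVec (signMul a b) i = sgnVec a i * sgnVec b i := by
  unfold sgnVec signMul
  cases a i <;> cases b i <;> norm_num

theorem signMul_involutive {d : ℕ} (b : Fin d → Bool) :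
    Function.Involutive fun a => signMul a b := by
  intro a
  funext i
  simp only [signMul]
  cases a i <;> cases b i <;> rfl

/-- The unnormalized Walsh transform `∑_a f(a) ∏_{i∈S} a_i`. -/
noncomputable def walshSum {d : ℕ} (f : (Fin d → Bool) → ℝ) (S : Finset (Fin d)) : ℝ :=
  ∑ a, f a * ∏ i ∈ S, sgnVec a i

theorem sum_prod_sgnVec_mul {d : ℕ} (a b : Fin d → Bool) :
    ∑ S : Finset (Fin d), (∏ i ∈ S, sgnVec a i) * ∏ i ∈ S, sgnVec b i =
      if a = b then 2 ^ d else 0 := by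
  simp_rw [← Finset.prod_mul_distrib]
  rw [← Finset.powerset_univ, ← Finset.prod_one_add]
  split_ifs with hab
  · subst hab
    simp only [sgnVec_mul_self]
    norm_num
  · obtain ⟨i, hi⟩ := Function.ne_iff.mp hab
    apply Finset.prod_eq_zero (Finset.mem_univ i)
    unfold sgnVec
    cases ha : a i <;> cases hb : b i <;> simp_all

/-- Parseval's identity on the Boolean cube. -/
theorem sum_walshSum_sq {d : ℕ} (f : (Fin d → Bool) → ℝ) :
    ∑ S, walshSum f S ^ 2 = 2 ^ d * ∑ a, f a ^ 2 := by
  calc ∑ S, walshSum f S ^ 2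
      = ∑ S : Finset (Fin d), ∑ a, ∑ b,
          f a * f b * ((∏ i ∈ S, sgnVec a i) * ∏ i ∈ S, sgnVec b i) := by
        refine Finset.sum_congr rfl fun S _ => ?_
        rw [walshSum, sq, Finset.sum_mul_sum]
        exact Finset.sum_congr rfl fun a _ => Finset.sum_congr rfl fun b _ => by ring
    _ = ∑ a, ∑ b, f a * f b * (if a = b then 2 ^ d else 0) := by
        rw [Finset.sum_comm]
        refine Finset.sum_congr rfl fun a _ => ?_
        rw [Finset.sum_comm]
        refine Finset.sum_congr rfl fun b _ => ?_
        rw [← Finset.mul_sum, sum_prod_sgnVec_mul]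
    _ = 2 ^ d * ∑ a, f a ^ 2 := by
        rw [Finset.mul_sum]
        refine Finset.sum_congr rfl fun a _ => ?_
        simp only [mul_ite, mul_zero, Finset.sum_ite_eq, Finset.mem_univ, if_true]
        ring

theorem walshSum_convolution {d : ℕ} (r g : (Fin d → Bool) → ℝ) (S : Finset (Fin d)) :
    walshSum (fun a => ∑ b, r b * g (signMul a b)) S = walshSum r S * walshSum g S := by
  have key : ∀ b, ∑ a, r b * g (signMul a b) * ∏ i ∈ S, sgnVec a i =
      (r b * ∏ i ∈ S, sgnVec b i) * walshSum g S := by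
    intro b
    rw [walshSum, ← Equiv.sum_comp (signMul_involutive b).toPerm, Finset.mul_sum]
    refine Finset.sum_congr rfl fun a _ => ?_
    have hχ : ∏ i ∈ S, sgnVec (signMul a b) i = (∏ i ∈ S, sgnVec a i) * ∏ i ∈ S, sgnVec b i := by
      simp only [sgnVec_signMul, Finset.prod_mul_distrib]
    simp only [Function.Involutive.coe_toPerm, (signMul_involutive b a : signMul (signMul a b) b = a),
      hχ]
    ring
  conv_lhs => rw [walshSum]
  simp_rw [Finset.sum_mul]
  rw [Finset.sum_comm]
  simp_rw [key]
  rw [← Finset.sum_mul]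
  rfl

theorem sum_convolution_sq_le {d : ℕ} (r g : (Fin d → Bool) → ℝ) (θ : ℝ)
    (hr : ∀ S, |walshSum r S| ≤ θ) (hg : ∀ a, |g a| ≤ 1) :
    ∑ a, (∑ b, r b * g (signMul a b)) ^ 2 ≤ θ ^ 2 * 2 ^ d := by
  have hpos : (0 : ℝ) < 2 ^ d := by positivity
  refine le_of_mul_le_mul_left ?_ hpos
  have hsum : ∑ a, g a ^ 2 ≤ 2 ^ d := by
    calc ∑ a, g a ^ 2 ≤ ∑ _a : Fin d → Bool, (1 : ℝ) :=
          Finset.sum_le_sum fun a _ => (sq_le_one_iff_abs_le_one _).mpr (hg a)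
      _ = 2 ^ d := by simp
  calc 2 ^ d * ∑ a, (∑ b, r b * g (signMul a b)) ^ 2
      = ∑ S, walshSum r S ^ 2 * walshSum g S ^ 2 := by
        rw [← sum_walshSum_sq]
        simp only [walshSum_convolution, mul_pow]
    _ ≤ ∑ S, θ ^ 2 * walshSum g S ^ 2 :=
        Finset.sum_le_sum fun S _ => mul_le_mul_of_nonneg_right
          (sq_le_sq.mpr ((hr S).trans (le_abs_self θ))) (sq_nonneg _)
    _ = θ ^ 2 * (2 ^ d * ∑ a, g a ^ 2) := by rw [← Finset.mul_sum, sum_walshSum_sq]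
    _ ≤ θ ^ 2 * (2 ^ d * 2 ^ d) := by gcongr
    _ = 2 ^ d * (θ ^ 2 * 2 ^ d) := by ring

theorem integral_eq_sum_sgnVec {d : ℕ} (P : Measure (Fin d → ℝ)) [IsProbabilityMeasure P]
    (hP : P (cube d) = 1) (f : (Fin d → ℝ) → ℝ) :
    ∫ x, f x ∂P = ∑ b, P.real {sgnVec b} * f (sgnVec b) := by
  classical
  have hc : ((Finset.univ.image (sgnVec (d := d)) : Finset _) : Set (Fin d → ℝ)) = cube d := by
    rw [Finset.coe_image, Finset.coe_univ, Set.image_univ, range_sgnVec]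
  have hm : MeasurableSet (cube d) := hc ▸ Finset.measurableSet _
  have hr : P.restrict (cube d) = P :=
    Measure.restrict_eq_self_of_ae_mem ((mem_ae_iff_prob_eq_one hm).mpr hP)
  have hi := setIntegral_finset (μ := P) (f := f) (Finset.univ.image (sgnVec (d := d)))
    IntegrableOn.finset
  rw [hc, hr, Finset.sum_image sgnVec_injective.injOn] at hi
  simpa only [smul_eq_mul] using hi

/-- Coordinatewise multiplication by a sign vector, as a measurable equivalence. -/
def flipEquiv {d : ℕ} (a : Fin d → Bool) : (Fin d → ℝ) ≃ᵐ (Fin d → ℝ) where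
  toFun x i := sgnVec a i * x i
  invFun x i := sgnVec a i * x i
  left_inv x := by funext i; simp only [← mul_assoc, sgnVec_mul_self, one_mul]
  right_inv x := by funext i; simp only [← mul_assoc, sgnVec_mul_self, one_mul]
  measurable_toFun := by
    change Measurable fun (x : Fin d → ℝ) i => sgnVec a i * x i
    fun_prop
  measurable_invFun := by
    change Measurable fun (x : Fin d → ℝ) i => sgnVec a i * x i
    fun_prop

theorem integral_flipped {d : ℕ} (P : Measure (Fin d → ℝ)) [IsProbabilityMeasure P]
    (hP : P (cube d) = 1) (h : (Fin d → ℝ) → ℝ) (a : Fin d → Bool) :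
    ∫ x, h x ∂(flipped P (sgnVec a)) =
      ∑ b, P.real {sgnVec b} * h (sgnVec (signMul a b)) := by
  calc ∫ x, h x ∂(flipped P (sgnVec a)) = ∫ x, h (flipEquiv a x) ∂P :=
        integral_map_equiv (flipEquiv a) h
    _ = ∑ b, P.real {sgnVec b} * h (flipEquiv a (sgnVec b)) :=
        integral_eq_sum_sgnVec P hP fun x => h (flipEquiv a x)
    _ = _ := by
        refine Finset.sum_congr rfl fun b _ => ?_
        congr 2
        exact (funext fun i => sgnVec_signMul a b i).symm

theorem card_le_abs_mul_sq_le {ι : Type*} [Fintype ι] (F : ι → ℝ) {t : ℝ} (ht : 0 < t)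
    [DecidablePred fun a => t ≤ |F a|] :
    ((Finset.univ.filter fun a => t ≤ |F a|).card : ℝ) * t ^ 2 ≤ ∑ a, F a ^ 2 := by
  rw [← nsmul_eq_mul, ← Finset.sum_const]
  calc ∑ _a ∈ Finset.univ.filter (fun a => t ≤ |F a|), t ^ 2
      ≤ ∑ a ∈ Finset.univ.filter (fun a => t ≤ |F a|), F a ^ 2 :=
        Finset.sum_le_sum fun a ha => by
          rw [← sq_abs (F a)]
          exact pow_le_pow_left₀ ht.le (Finset.mem_filter.mp ha).2 2
    _ ≤ ∑ a, F a ^ 2 :=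
        Finset.sum_le_sum_of_subset_of_nonneg (Finset.filter_subset _ _)
          fun a _ _ => sq_nonneg _

open scoped Classical in
/-- Chebyshev bound: for probability distributions `P, Q` on `{-1,1}^d` with
`|P̂(S) - Q̂(S)| ≤ θ` for all `S`, and `h : {-1,1}^d → [-1,1]`, for every `t > 0`,
`Pr_{a∼Unif({-1,1}^d)}[|E_{P_a}[h] - E_{Q_a}[h]| ≥ t] ≤ θ²/t²`. -/
theorem chebyshev_for_flips (d : ℕ) (P Q : Measure (Fin d → ℝ))
    [IsProbabilityMeasure P] [IsProbabilityMeasure Q]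
    (hP : P (cube d) = 1) (hQ : Q (cube d) = 1) (θ : ℝ)
    (hθ : ∀ S : Finset (Fin d), |cubeFourier P S - cubeFourier Q S| ≤ θ)
    (h : (Fin d → ℝ) → ℝ) (hh : ∀ x ∈ cube d, |h x| ≤ 1) (t : ℝ) (ht : 0 < t) :
    ((Finset.univ.filter fun a : Fin d → Bool =>
        t ≤ |(∫ x, h x ∂(flipped P (sgnVec a))) - ∫ x, h x ∂(flipped Q (sgnVec a))|).card : ℝ)
      / 2 ^ d ≤ θ ^ 2 / t ^ 2 := by
  set r : (Fin d → Bool) → ℝ := fun b => P.real {sgnVec b} - Q.real {sgnVec b} with hr_def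
  have hdiff : ∀ a, (∫ x, h x ∂(flipped P (sgnVec a))) - ∫ x, h x ∂(flipped Q (sgnVec a)) =
      ∑ b, r b * h (sgnVec (signMul a b)) := by
    intro a
    rw [integral_flipped P hP, integral_flipped Q hQ, ← Finset.sum_sub_distrib]
    simp only [hr_def, sub_mul]
  have hr : ∀ S, |walshSum r S| ≤ θ := by
    intro S
    have hS := hθ S
    rw [cubeFourier, cubeFourier, integral_eq_sum_sgnVec P hP, integral_eq_sum_sgnVec Q hQ,
      ← Finset.sum_sub_distrib] at hS
    simpa only [walshSum, hr_def, sub_mul] using hS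
  have hg : ∀ a : Fin d → Bool, |h (sgnVec a)| ≤ 1 :=
    fun a => hh _ (range_sgnVec d ▸ Set.mem_range_self a)
  rw [div_le_div_iff₀ (by positivity) (by positivity)]
  refine (card_le_abs_mul_sq_le _ ht).trans ?_
  simp only [hdiff]
  exact sum_convolution_sq_le r (fun a => h (sgnVec a)) θ hr hg
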